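/- For all real numbers b and t with 0 ≤ t ≤ b, the variable-periodic sine activation σ(x) = sin((|x| + 1) x) has at least ⌊2t(2b + 1)/π⌋ zeros in the interval [b − t, b + t]. Hence the number of oscillations of the selected sub-function in a fixed-width window grows linearly with the bias b. -/

import Mathlib

open Real

/-- A continuous phase `f` on `[a, c]` makes `sin ∘ f` vanish at least `⌊(f c - f a) / π⌋` times. -/
lemma exists_finset_zeros_sin_comp {f : ℝ → ℝ} {a c : ℝ} (hac : a ≤ c)
    (hf : ContinuousOn f (Set.Icc a c)) :
    ∃ S : Finset ℝ, (↑S : Set ℝ) ⊆ {x : ℝ | x ∈ Set.Icc a c ∧ Real.sin (f x) = 0} ∧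
      ⌊(f c - f a) / π⌋ ≤ (S.card : ℤ) := by
  classical
  have hπ := Real.pi_pos
  have hex : ∀ k ∈ Finset.Icc ⌈f a / π⌉ ⌊f c / π⌋, ∃ x ∈ Set.Icc a c, f x = k * π := by
    intro k hk
    rw [Finset.mem_Icc, Int.ceil_le, Int.le_floor, div_le_iff₀ hπ, le_div_iff₀ hπ] at hk
    exact intermediate_value_Icc hac hf hk
  choose! g hg hfg using hex
  refine ⟨(Finset.Icc ⌈f a / π⌉ ⌊f c / π⌋).image g, ?_, ?_⟩
  · intro x hx
    obtain ⟨k, hk, rfl⟩ := Finset.mem_image.1 (Finset.mem_coe.1 hx)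
    exact ⟨hg k hk, by rw [hfg k hk, Real.sin_int_mul_pi]⟩
  · rw [Finset.card_image_of_injOn, Int.card_Icc]
    · refine le_trans ?_ (Int.self_le_toNat _)
      rw [← Int.lt_add_one_iff, Int.floor_lt, sub_div]
      push_cast
      linarith [Int.lt_floor_add_one (f c / π), Int.ceil_lt_add_one (f a / π)]
    · intro k hk l hl hkl
      have h : (k : ℝ) * π = l * π := by rw [← hfg k hk, ← hfg l hl, hkl]
      exact_mod_cast mul_right_cancel₀ hπ.ne' h

/-- For all reals `b`, `t` with `0 ≤ t ≤ b`, the variable-periodic sine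
activation `σ(x) = sin((|x| + 1) x)` has at least `⌊2t(2b + 1)/π⌋` zeros in
the interval `[b − t, b + t]`: the number of oscillations of the selected
sub-function in a fixed-width window grows linearly with the bias `b`. -/
theorem finer_zero_count_in_window (b t : ℝ) (ht : 0 ≤ t) (htb : t ≤ b) :
    ∃ S : Finset ℝ,
      (↑S : Set ℝ) ⊆ {x : ℝ | x ∈ Set.Icc (b - t) (b + t) ∧
        Real.sin ((|x| + 1) * x) = 0} ∧
      ⌊2 * t * (2 * b + 1) / π⌋ ≤ (S.card : ℤ) := by
  have hphase : (|b + t| + 1) * (b + t) - (|b - t| + 1) * (b - t) = 2 * t * (2 * b + 1) := by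
    rw [abs_of_nonneg (by linarith), abs_of_nonneg (by linarith)]
    ring
  rw [← hphase]
  exact exists_finset_zeros_sin_comp (f := fun x ↦ (|x| + 1) * x) (by linarith) (by fun_prop)
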